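/- The full structure theorem: every state experiment probability system (Σ, Q, μ) gives rise to a state property system (Σ, ≤, L, ≤, ∧, ∨, ξ), i.e. Σ is preordered, L is a complete lattice, ξ : Σ → 𝒫(L) satisfies: I ∈ ξ(p) and 0 ∉ ξ(p) for all p; a_i ∈ ξ(p) for all i iff ∧_i a_i ∈ ξ(p); p ≤ q iff ξ(q) ⊆ ξ(p); and a ≤ b iff for all r, a ∈ ξ(r) implies b ∈ ξ(r). -/

import Mathlib

open Set

/-- The operation `V ↦ 1 - V` on subsets of `[0,1]`. -/
def oneMinus (V : Set ℝ) : Set ℝ := {x | x ∈ Set.Icc (0:ℝ) 1 ∧ 1 - x ∈ V}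

/-- A state experiment probability system (Aerts): states `S`, yes/no-experiments `Q`,
subset probability `mu`, products of arbitrary families, inverse experiments and a unit. -/
structure SEP (S Q : Type) : Type 1 where
  mu : Q → S → Set ℝ
  mu_sub : ∀ α p, mu α p ⊆ Set.Icc (0:ℝ) 1
  prod : {I : Type} → (I → Q) → Q
  mu_prod : ∀ {I : Type} (α : I → Q) (p : S), mu (prod α) p = ⋃ i, mu (α i) p
  inv : Q → Q
  inv_inv : ∀ α, inv (inv α) = α
  inv_prod : ∀ {I : Type} (α : I → Q), inv (prod α) = prod (fun i => inv (α i))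
  mu_inv : ∀ α p, mu (inv α) p = oneMinus (mu α p)
  tau : Q
  mu_tau : ∀ p, mu tau p = ({1} : Set ℝ)

variable {S Q : Type}

/-- `p ≤ q` on states: every experiment certain in `q` is certain in `p`. -/
def stateLe (E : SEP S Q) (p q : S) : Prop :=
  ∀ γ : Q, E.mu γ q ⊆ ({1} : Set ℝ) → E.mu γ p ⊆ ({1} : Set ℝ)

/-- The certainty preorder on experiments. -/
def certLe (E : SEP S Q) (α β : Q) : Prop :=
  ∀ r : S, E.mu α r ⊆ ({1} : Set ℝ) → E.mu β r ⊆ ({1} : Set ℝ)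

/-- The certainty equivalence on experiments, as a setoid. -/
def certSetoid (E : SEP S Q) : Setoid Q where
  r α β := certLe E α β ∧ certLe E β α
  iseqv := ⟨fun _ => ⟨fun _ h => h, fun _ h => h⟩,
    fun h => ⟨h.2, h.1⟩,
    fun h1 h2 => ⟨fun r h => h2.1 r (h1.1 r h), fun r h => h1.2 r (h2.2 r h)⟩⟩

/-- The quotient set `L` of equivalence classes of experiments. -/
def Lq (E : SEP S Q) := Quotient (certSetoid E)

noncomputable instance (E : SEP S Q) : Preorder (Lq E) where
  le a b := Quotient.liftOn₂ a b (certLe E)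
    (fun _ _ _ _ h1 h2 => propext
      ⟨fun h r hr => h2.1 r (h r (h1.2 r hr)), fun h r hr => h2.2 r (h r (h1.1 r hr))⟩)
  le_refl a := by
    induction a using Quotient.ind
    exact fun r h => h
  le_trans a b c := by
    induction a using Quotient.ind
    induction b using Quotient.ind
    induction c using Quotient.ind
    exact fun h1 h2 r h => h2 r (h1 r h)

noncomputable instance (E : SEP S Q) : PartialOrder (Lq E) where
  le_antisymm a b := by
    induction a using Quotient.ind
    induction b using Quotient.ind
    exact fun h1 h2 => Quotient.sound ⟨h1, h2⟩

/-- The set of properties (equivalence classes of experiments) actual in state `p`. -/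
def xi (E : SEP S Q) (p : S) : Set (Lq E) :=
  {a | ∀ α : Q, Quotient.mk (certSetoid E) α = a → E.mu α p ⊆ ({1} : Set ℝ)}

theorem mk_mem_xi (E : SEP S Q) (p : S) (α : Q) :
    ((Quotient.mk (certSetoid E) α : Lq E) ∈ xi E p) ↔ E.mu α p ⊆ ({1} : Set ℝ) := by
  constructor
  · intro h
    exact h α rfl
  · intro h β hβ
    have h2 : certLe E β α ∧ certLe E α β := Quotient.exact hβ
    exact h2.2 p h

theorem le_iff_xi (E : SEP S Q) (a b : Lq E) :
    a ≤ b ↔ ∀ r : S, a ∈ xi E r → b ∈ xi E r := by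
  obtain ⟨α, rfl⟩ := Quotient.exists_rep a
  obtain ⟨β, rfl⟩ := Quotient.exists_rep b
  constructor
  · intro h r hr
    exact (mk_mem_xi E r β).2 (h r ((mk_mem_xi E r α).1 hr))
  · intro h r hr
    exact (mk_mem_xi E r β).1 (h r ((mk_mem_xi E r α).2 hr))

theorem prod_mem_xi (E : SEP S Q) {I : Type} (a : I → Lq E) (α : I → Q)
    (h : ∀ i, Quotient.mk (certSetoid E) (α i) = a i) (p : S) :
    (∀ i, a i ∈ xi E p) ↔ (Quotient.mk (certSetoid E) (E.prod α) : Lq E) ∈ xi E p := by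
  rw [mk_mem_xi, E.mu_prod, Set.iUnion_subset_iff]
  refine forall_congr' fun i => ?_
  rw [← mk_mem_xi]
  exact iff_of_eq (congrArg (fun x : Lq E => x ∈ xi E p) (h i).symm)

theorem prod_isGLB (E : SEP S Q) {I : Type} (a : I → Lq E) (α : I → Q)
    (h : ∀ i, Quotient.mk (certSetoid E) (α i) = a i) :
    IsGLB (Set.range a) (Quotient.mk (certSetoid E) (E.prod α) : Lq E) := by
  constructor
  · rintro _ ⟨i, rfl⟩
    exact (le_iff_xi E _ _).2 fun r hr => (prod_mem_xi E a α h r).2 hr i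
  · intro b hb
    exact (le_iff_xi E _ _).2 fun r hr =>
      (prod_mem_xi E a α h r).1 fun i => (le_iff_xi E _ _).1 (hb ⟨i, rfl⟩) r hr

theorem exists_isGLB_Lq (E : SEP S Q) (s : Set (Lq E)) : ∃ x, IsGLB s x := by
  have hrep : ∀ a : s, ∃ α : Q, (Quotient.mk (certSetoid E) α : Lq E) = a.1 :=
    fun a => Quotient.exists_rep a.1
  choose α hα using hrep
  have := prod_isGLB E (fun a : s => a.1) α hα
  rw [Subtype.range_val] at this
  exact ⟨_, this⟩

/-- The full structure theorem: every state experiment probability system gives rise to a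
state property system `(Σ, ≤, L, ≤, ∧, ∨, ξ)`. -/
theorem sep_gives_state_property_system (E : SEP S Q) :
    -- Σ is preordered by `stateLe`
    IsPreorder S (stateLe E) ∧
    -- L is a complete lattice: every subset has an infimum and a supremum,
    -- the infimum of a family of classes being the class of the product of representatives
    (∀ s : Set (Lq E), (∃ x, IsGLB s x) ∧ (∃ y, IsLUB s y)) ∧
    (∀ {I : Type} (a : I → Lq E) (α : I → Q),
      (∀ i, Quotient.mk (certSetoid E) (α i) = a i) →
      IsGLB (Set.range a) (Quotient.mk (certSetoid E) (E.prod α))) ∧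
    -- I ∈ ξ(p) and 0 ∉ ξ(p) for every state p
    (∀ p : S, (Quotient.mk (certSetoid E) E.tau : Lq E) ∈ xi E p) ∧
    (∀ p : S, (Quotient.mk (certSetoid E) (E.inv E.tau) : Lq E) ∉ xi E p) ∧
    -- a_i ∈ ξ(p) for all i iff ∧_i a_i ∈ ξ(p)
    (∀ {I : Type} (a : I → Lq E) (α : I → Q),
      (∀ i, Quotient.mk (certSetoid E) (α i) = a i) → ∀ p : S,
      ((∀ i, a i ∈ xi E p) ↔ Quotient.mk (certSetoid E) (E.prod α) ∈ xi E p)) ∧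
    -- p ≤ q iff ξ(q) ⊆ ξ(p)
    (∀ p q : S, stateLe E p q ↔ xi E q ⊆ xi E p) ∧
    -- a ≤ b iff for all r, a ∈ ξ(r) implies b ∈ ξ(r)
    (∀ a b : Lq E, a ≤ b ↔ ∀ r : S, a ∈ xi E r → b ∈ xi E r) := by
  refine ⟨?_, ?_, fun a α h => prod_isGLB E a α h, ?_, ?_,
    fun a α h p => prod_mem_xi E a α h p, ?_, le_iff_xi E⟩
  · exact { refl := fun p γ h => h, trans := fun p q r h1 h2 γ h => h1 γ (h2 γ h) }
  · intro s
    refine ⟨exists_isGLB_Lq E s, ?_⟩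
    obtain ⟨y, hy⟩ := exists_isGLB_Lq E (upperBounds s)
    exact ⟨y, isGLB_upperBounds.1 hy⟩
  · intro p
    exact (mk_mem_xi E p _).2 (E.mu_tau p).subset
  · intro p hp
    have h := (mk_mem_xi E p _).1 hp
    rw [E.mu_inv, E.mu_tau] at h
    have h0 : (0 : ℝ) ∈ oneMinus {1} := by simp [oneMinus]
    have := h h0
    simp at this
  · intro p q
    constructor
    · intro h a ha α hα
      exact h α (ha α hα)
    · intro h γ hγ
      exact (mk_mem_xi E p γ).1 (h ((mk_mem_xi E q γ).2 hγ))
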